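/- Let Λ₁, Λ₂: ℝ → ℝ be real analytic, positive, 1-periodic functions with Λ₁ nonconstant, and let Λ, u₀, f, g be a real analytic solution of system (11) on ℝ² × (−ε, ε), doubly periodic in (x,y), with the Liouville initial data. Suppose V₂, V₃, V₄: ℝ² × (−ε, ε) → ℝ are real analytic, doubly periodic in (x,y), vanish identically at t = 0, and satisfy on ℝ² × (−ε, ε): g·(V₂)_t = 2(g g_x + 2Λ_x + (u₀)_x)·V₂ + (4Λ f_x + 2fΛ_x)·V₃ − 4V₂V₃ + g·(g(V₂)_x − 2Λ(V₄)_x + f(V₂)_y + 2Λ(V₃)_y − 2Λ_x V₄); (V₃)_t = 2(V₂)_y + f(V₃)_y + g(V₄)_y + f_y V₃ − f_x V₄; (V₄)_t = −2(V₂)_x + f(V₃)_x + g(V₄)_x − g_y V₃ + g_x V₄. Then V₂ ≡ V₃ ≡ V₄ ≡ 0. -/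

import Mathlib

open Set

/-- Partial derivative in `x`. -/
noncomputable def pX (h : ℝ × ℝ × ℝ → ℝ) (p : ℝ × ℝ × ℝ) : ℝ := fderiv ℝ h p (1, 0, 0)

/-- Partial derivative in `y`. -/
noncomputable def pY (h : ℝ × ℝ × ℝ → ℝ) (p : ℝ × ℝ × ℝ) : ℝ := fderiv ℝ h p (0, 1, 0)

/-- Partial derivative in `t`. -/
noncomputable def pT (h : ℝ × ℝ × ℝ → ℝ) (p : ℝ × ℝ × ℝ) : ℝ := fderiv ℝ h p (0, 0, 1)

/-- The strip `ℝ² × (-ε, ε)` in coordinates `(x, y, t)`. -/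
def Strip (ε : ℝ) : Set (ℝ × ℝ × ℝ) := {p : ℝ × ℝ × ℝ | p.2.2 ∈ Ioo (-ε) ε}

/-- `h` is doubly periodic in `(x,y)` on the strip `ℝ² × (-ε,ε)`. -/
def DoublyPeriodicOn (ε : ℝ) (h : ℝ × ℝ × ℝ → ℝ) : Prop :=
  ∀ x y t : ℝ, t ∈ Ioo (-ε) ε →
    h (x + 1, y, t) = h (x, y, t) ∧ h (x, y + 1, t) = h (x, y, t)

/-- System (11) of the paper holds at the point `p`. -/
def System11At (Λ u₀ f g : ℝ × ℝ × ℝ → ℝ) (p : ℝ × ℝ × ℝ) : Prop :=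
  pT Λ p = g p * pX Λ p + Λ p * pX g p + f p * pY Λ p + Λ p * pY f p ∧
  pT u₀ p = -2 * g p * pX Λ p + g p * pX u₀ p - 2 * Λ p * pX g p
      + 2 * f p * pY Λ p + f p * pY u₀ p + 2 * Λ p * pY f p ∧
  pT f p = 2 * pY u₀ p ∧
  pT g p = -2 * pX u₀ p

/-- `Λ, u₀, f, g` is a real analytic, doubly periodic in `(x,y)`, solution of the Cauchy
problem for system (11) with Liouville initial data `Λ = Λ₁(x) + Λ₂(y)`,
`u₀ = 2Λ₂(y) - 2Λ₁(x)`, `f = g = 0` at `t = 0`, on the strip `ℝ² × (-ε, ε)`. -/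
def IsCauchySolution (Λ₁ Λ₂ : ℝ → ℝ) (ε : ℝ) (Λ u₀ f g : ℝ × ℝ × ℝ → ℝ) : Prop :=
  AnalyticOnNhd ℝ Λ (Strip ε) ∧ AnalyticOnNhd ℝ u₀ (Strip ε) ∧
  AnalyticOnNhd ℝ f (Strip ε) ∧ AnalyticOnNhd ℝ g (Strip ε) ∧
  DoublyPeriodicOn ε Λ ∧ DoublyPeriodicOn ε u₀ ∧
  DoublyPeriodicOn ε f ∧ DoublyPeriodicOn ε g ∧
  (∀ p ∈ Strip ε, System11At Λ u₀ f g p) ∧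
  (∀ x y : ℝ, Λ (x, y, 0) = Λ₁ x + Λ₂ y ∧ u₀ (x, y, 0) = 2 * Λ₂ y - 2 * Λ₁ x ∧
    f (x, y, 0) = 0 ∧ g (x, y, 0) = 0)

open Filter Topology

lemma isOpen_strip (ε : ℝ) : IsOpen (Strip ε) :=
  isOpen_Ioo.preimage (continuous_snd.comp continuous_snd)

lemma isPreconnected_strip (ε : ℝ) : IsPreconnected (Strip ε) := by
  have h : Convex ℝ (Strip ε) :=
    (convex_Ioo (-ε) ε).linear_preimage
      ((LinearMap.snd ℝ ℝ ℝ).comp (LinearMap.snd ℝ ℝ (ℝ × ℝ)))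
  exact h.isPreconnected

lemma mem_strip_zero {ε : ℝ} (hε : 0 < ε) (x y : ℝ) : (x, y, (0 : ℝ)) ∈ Strip ε :=
  ⟨neg_lt_zero.mpr hε, hε⟩

lemma AnalyticOnNhd.fderiv_apply {E F : Type*} [NormedAddCommGroup E] [NormedSpace ℝ E]
    [NormedAddCommGroup F] [NormedSpace ℝ F] [CompleteSpace F] {h : E → F} {s : Set E}
    (hh : AnalyticOnNhd ℝ h s) (v : E) : AnalyticOnNhd ℝ (fun p => fderiv ℝ h p v) s :=
  fun p hp => ((ContinuousLinearMap.apply ℝ F v).analyticAt _).comp (hh.fderiv p hp)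

lemma AnalyticAt.fderiv_fderiv_apply_comm {E F : Type*} [NormedAddCommGroup E] [NormedSpace ℝ E]
    [NormedAddCommGroup F] [NormedSpace ℝ F] [CompleteSpace F] {h : E → F} {p : E}
    (hh : AnalyticAt ℝ h p) (v w : E) :
    fderiv ℝ (fun q => fderiv ℝ h q v) p w = fderiv ℝ (fun q => fderiv ℝ h q w) p v := by
  have hd : DifferentiableAt ℝ (fderiv ℝ h) p := hh.fderiv.differentiableAt
  rw [fderiv_clm_apply hd (differentiableAt_const _),
    fderiv_clm_apply hd (differentiableAt_const _)]
  simpa using hh.contDiffAt.isSymmSndFDerivAt_of_omega w v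

section Slice

variable {ε : ℝ} {h : ℝ × ℝ × ℝ → ℝ}

lemma AnalyticOnNhd.slice (hh : AnalyticOnNhd ℝ h (Strip ε)) (x y : ℝ) :
    AnalyticOnNhd ℝ (fun t => h (x, y, t)) (Ioo (-ε) ε) := fun t ht =>
  AnalyticAt.comp (g := h) (f := fun t : ℝ => (x, y, t)) (hh (x, y, t) ht)
    (analyticAt_const.prod (analyticAt_const.prod analyticAt_id))

lemma AnalyticOnNhd.deriv_slice (hh : AnalyticOnNhd ℝ h (Strip ε)) (x y : ℝ) {t : ℝ}
    (ht : t ∈ Ioo (-ε) ε) : deriv (fun t => h (x, y, t)) t = pT h (x, y, t) := by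
  have h1 : HasFDerivAt h (fderiv ℝ h (x, y, t)) (x, y, t) :=
    (hh (x, y, t) ht).differentiableAt.hasFDerivAt
  have h2 : HasDerivAt (fun t : ℝ => (x, y, t)) ((0 : ℝ), (0 : ℝ), (1 : ℝ)) t :=
    (hasDerivAt_const t x).prodMk ((hasDerivAt_const t y).prodMk (hasDerivAt_id t))
  exact (h1.comp_hasDerivAt t h2).deriv

lemma hasDerivAt_slice_x {p : ℝ × ℝ × ℝ} (hh : DifferentiableAt ℝ h p) :
    HasDerivAt (fun s => h (s, p.2)) (pX h p) p.1 :=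
  HasFDerivAt.comp_hasDerivAt (f := fun s : ℝ => (s, p.2)) p.1 hh.hasFDerivAt
    ((hasDerivAt_id p.1).prodMk (hasDerivAt_const p.1 p.2))

end Slice

/-- `h` is real analytic on the strip and vanishes to order at least `n` in `t` at every point
`(x, y, 0)` with `x ∈ S`. -/
def VanishesToOrder (ε : ℝ) (S : Set ℝ) (n : ℕ) (h : ℝ × ℝ × ℝ → ℝ) : Prop :=
  AnalyticOnNhd ℝ h (Strip ε) ∧
    ∀ x ∈ S, ∀ y, (n : ℕ∞) ≤ analyticOrderAt (fun t => h (x, y, t)) 0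

namespace VanishesToOrder

variable {ε : ℝ} {S : Set ℝ} {m n : ℕ} {h k : ℝ × ℝ × ℝ → ℝ}

lemma of_analytic (hh : AnalyticOnNhd ℝ h (Strip ε)) : VanishesToOrder ε S 0 h :=
  ⟨hh, fun _ _ _ => by simp⟩

lemma mono (hh : VanishesToOrder ε S n h) (hmn : m ≤ n) : VanishesToOrder ε S m h :=
  ⟨hh.1, fun x hx y => le_trans (by exact_mod_cast hmn) (hh.2 x hx y)⟩

lemma add (hh : VanishesToOrder ε S n h) (hk : VanishesToOrder ε S n k) :
    VanishesToOrder ε S n (fun p => h p + k p) :=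
  ⟨hh.1.add hk.1, fun x hx y => (le_min (hh.2 x hx y) (hk.2 x hx y)).trans le_analyticOrderAt_add⟩

lemma sub (hh : VanishesToOrder ε S n h) (hk : VanishesToOrder ε S n k) :
    VanishesToOrder ε S n (fun p => h p - k p) :=
  ⟨hh.1.sub hk.1, fun x hx y => (le_min (hh.2 x hx y) (hk.2 x hx y)).trans le_analyticOrderAt_sub⟩

lemma analyticAt_slice (hε : 0 < ε) (hh : AnalyticOnNhd ℝ h (Strip ε)) (x y : ℝ) :
    AnalyticAt ℝ (fun t => h (x, y, t)) 0 :=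
  hh.slice x y 0 (mem_strip_zero hε x y)

lemma mul (hε : 0 < ε) (hh : VanishesToOrder ε S m h) (hk : VanishesToOrder ε S n k) :
    VanishesToOrder ε S (m + n) (fun p => h p * k p) := by
  refine ⟨hh.1.mul hk.1, fun x hx y => ?_⟩
  have key := analyticOrderAt_mul (analyticAt_slice hε hh.1 x y) (analyticAt_slice hε hk.1 x y)
  rw [Nat.cast_add]
  exact (add_le_add (hh.2 x hx y) (hk.2 x hx y)).trans key.ge

lemma const_mul (hε : 0 < ε) (c : ℝ) (hh : VanishesToOrder ε S n h) :
    VanishesToOrder ε S n (fun p => c * h p) := by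
  simpa using (of_analytic (S := S) (h := fun _ => c) analyticOnNhd_const).mul hε hh

lemma congr (hε : 0 < ε) (hh : VanishesToOrder ε S n h) (hk : EqOn h k (Strip ε)) :
    VanishesToOrder ε S n k := by
  refine ⟨hh.1.congr (isOpen_strip ε) hk, fun x hx y => (hh.2 x hx y).trans_eq ?_⟩
  refine analyticOrderAt_congr ?_
  filter_upwards [Ioo_mem_nhds (neg_lt_zero.mpr hε) hε] with t ht using hk (x := (x, y, t)) ht

lemma analyticOrderAt_pT (hε : 0 < ε) (hh : AnalyticOnNhd ℝ h (Strip ε)) (x y : ℝ) :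
    analyticOrderAt (deriv fun t => h (x, y, t)) 0 =
      analyticOrderAt (fun t => pT h (x, y, t)) 0 := by
  refine analyticOrderAt_congr ?_
  filter_upwards [Ioo_mem_nhds (neg_lt_zero.mpr hε) hε] with t ht using hh.deriv_slice x y ht

lemma eq_zero (hh : VanishesToOrder ε S (n + 1) h) {x : ℝ} (hx : x ∈ S) (y : ℝ) :
    h (x, y, 0) = 0 := by
  refine apply_eq_zero_of_analyticOrderAt_ne_zero (𝕜 := ℝ) (f := fun t => h (x, y, t)) ?_
  intro h0
  have := hh.2 x hx y
  rw [h0] at this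
  norm_cast at this

lemma succ_iff (hε : 0 < ε) (hh : AnalyticOnNhd ℝ h (Strip ε)) :
    VanishesToOrder ε S (n + 1) h ↔
      (∀ x ∈ S, ∀ y, h (x, y, 0) = 0) ∧ VanishesToOrder ε S n (pT h) := by
  have key (x y : ℝ) (h0 : h (x, y, 0) = 0) :
      (n : ℕ∞) ≤ analyticOrderAt (fun t => pT h (x, y, t)) 0 ↔
        ((n + 1 : ℕ) : ℕ∞) ≤ analyticOrderAt (fun t => h (x, y, t)) 0 := by
    rw [← analyticOrderAt_pT hε hh, Nat.cast_add_one]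
    exact analyticOrderAt_deriv_ge_iff (analyticAt_slice hε hh x y) h0
  constructor
  · intro hv
    exact ⟨fun x hx y => hv.eq_zero hx y, hh.fderiv_apply _,
      fun x hx y => (key x y (hv.eq_zero hx y)).2 (hv.2 x hx y)⟩
  · rintro ⟨h0, hv⟩
    exact ⟨hh, fun x hx y => (key x y (h0 x hx y)).1 (hv.2 x hx y)⟩

lemma one_iff (hε : 0 < ε) (hh : AnalyticOnNhd ℝ h (Strip ε)) :
    VanishesToOrder ε S 1 h ↔ ∀ x ∈ S, ∀ y, h (x, y, 0) = 0 :=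
  (succ_iff hε hh).trans (and_iff_left (of_analytic (hh.fderiv_apply _)))

lemma fderiv_horizontal (hε : 0 < ε) (hS : IsOpen S) (a b : ℝ)
    (hh : VanishesToOrder ε S n h) :
    VanishesToOrder ε S n (fun p => fderiv ℝ h p (a, b, 0)) := by
  induction n generalizing h with
  | zero => exact of_analytic (hh.1.fderiv_apply _)
  | succ n ih =>
    obtain ⟨h0, hT⟩ := (succ_iff hε hh.1).1 hh
    refine (succ_iff hε (hh.1.fderiv_apply _)).2 ⟨fun x hx y => ?_, ?_⟩
    · have hγ : HasDerivAt (fun s : ℝ => (x + s * a, y + s * b, (0 : ℝ))) (a, b, (0 : ℝ)) 0 := by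
        refine HasDerivAt.prodMk ?_ (HasDerivAt.prodMk ?_ (hasDerivAt_const _ _))
        · simpa using ((hasDerivAt_id (0 : ℝ)).mul_const a).const_add x
        · simpa using ((hasDerivAt_id (0 : ℝ)).mul_const b).const_add y
      have hd : HasFDerivAt h (fderiv ℝ h (x, y, 0)) (x + 0 * a, y + 0 * b, 0) := by
        simpa using (hh.1 _ (mem_strip_zero hε x y)).differentiableAt.hasFDerivAt
      have hev : (fun s : ℝ => h (x + s * a, y + s * b, 0)) =ᶠ[𝓝 0] fun _ => 0 := by
        have hc : ContinuousAt (fun s : ℝ => x + s * a) 0 := by fun_prop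
        filter_upwards [hc.preimage_mem_nhds (hS.mem_nhds (by simpa using hx))] with s hs
        exact h0 _ hs _
      have h1 := (HasFDerivAt.comp_hasDerivAt (0 : ℝ) hd hγ).deriv
      have h2 := hev.deriv_eq
      rw [deriv_const] at h2
      exact h1.symm.trans h2
    · exact (ih hT).congr hε fun p hp => (hh.1 p hp).fderiv_fderiv_apply_comm _ _

lemma pX (hε : 0 < ε) (hS : IsOpen S) (hh : VanishesToOrder ε S n h) :
    VanishesToOrder ε S n (pX h) :=
  hh.fderiv_horizontal hε hS 1 0

lemma pY (hε : 0 < ε) (hS : IsOpen S) (hh : VanishesToOrder ε S n h) :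
    VanishesToOrder ε S n (pY h) :=
  hh.fderiv_horizontal hε hS 0 1

lemma of_mul_left (hε : 0 < ε) (hh : AnalyticOnNhd ℝ h (Strip ε))
    (hk : AnalyticOnNhd ℝ k (Strip ε))
    (hk0 : ∀ x ∈ S, ∀ y, k (x, y, 0) = 0) (hk1 : ∀ x ∈ S, ∀ y, _root_.pT k (x, y, 0) ≠ 0)
    (hkh : VanishesToOrder ε S (n + 1) (fun p => k p * h p)) : VanishesToOrder ε S n h := by
  refine ⟨hh, fun x hx y => ?_⟩
  have hka := analyticAt_slice hε hk x y
  have h1 : analyticOrderAt (fun t => k (x, y, t)) 0 = 1 := by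
    refine hka.analyticOrderAt_eq_one_of_zero_deriv_ne_zero (hk0 x hx y) ?_
    rw [hk.deriv_slice x y (mem_strip_zero hε x y)]
    exact hk1 x hx y
  have h2 := (hkh.2 x hx y).trans_eq (analyticOrderAt_mul hka (analyticAt_slice hε hh x y))
  rw [h1, Nat.cast_add_one, add_comm] at h2
  exact (ENat.add_le_add_iff_left ENat.one_ne_top).1 h2

lemma eqOn_zero (hε : 0 < ε) (hS : IsOpen S) (hne : S.Nonempty)
    (hh : ∀ n, VanishesToOrder ε S n h) : EqOn h 0 (Strip ε) := by
  obtain ⟨x₀, hx₀⟩ := hne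
  refine (hh 0).1.eqOn_zero_of_preconnected_of_eventuallyEq_zero (isPreconnected_strip ε)
    (mem_strip_zero hε x₀ 0) ?_
  have hU : {p : ℝ × ℝ × ℝ | p.1 ∈ S} ∈ 𝓝 (x₀, (0 : ℝ), (0 : ℝ)) :=
    (hS.preimage continuous_fst).mem_nhds hx₀
  filter_upwards [hU, (isOpen_strip ε).mem_nhds (mem_strip_zero hε x₀ 0)] with p hp hpε
  obtain ⟨x, y, t⟩ := p
  have htop : analyticOrderAt (fun t => h (x, y, t)) 0 = ⊤ :=
    ENat.eq_top_iff_forall_ge.2 fun n => (hh n).2 x hp y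
  exact ((hh 0).1.slice x y).eqOn_zero_of_preconnected_of_eventuallyEq_zero isPreconnected_Ioo
    (mem_strip_zero hε x y) (analyticOrderAt_eq_top.1 htop) hpε

end VanishesToOrder

lemma exists_deriv_ne_zero {φ : ℝ → ℝ} (hφ : Differentiable ℝ φ) (hnc : ∃ a b, φ a ≠ φ b) :
    ∃ x, deriv φ x ≠ 0 := by
  by_contra! h
  obtain ⟨a, b, hab⟩ := hnc
  exact hab (is_const_of_deriv_eq_zero hφ h a b)

/-- Uniqueness for system (14) (multiplied through by `g` in the first
equation): if `V₂, V₃, V₄` are real analytic, doubly periodic in `(x,y)`, vanish at `t = 0`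
and satisfy system (14) along the analytic solution of system (11) with Liouville initial
data (with `Λ₁` nonconstant), then they vanish identically. -/
theorem statement3
    (Λ₁ Λ₂ : ℝ → ℝ)
    (hΛ₁a : AnalyticOnNhd ℝ Λ₁ univ) (hΛ₂a : AnalyticOnNhd ℝ Λ₂ univ)
    (hΛ₁pos : ∀ x, 0 < Λ₁ x) (hΛ₂pos : ∀ y, 0 < Λ₂ y)
    (hΛ₁per : Function.Periodic Λ₁ 1) (hΛ₂per : Function.Periodic Λ₂ 1)
    (hΛ₁nc : ∃ a b : ℝ, Λ₁ a ≠ Λ₁ b)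
    (ε : ℝ) (hε : 0 < ε)
    (Λ u₀ f g : ℝ × ℝ × ℝ → ℝ)
    (hsol : IsCauchySolution Λ₁ Λ₂ ε Λ u₀ f g)
    (V₂ V₃ V₄ : ℝ × ℝ × ℝ → ℝ)
    (hV₂a : AnalyticOnNhd ℝ V₂ (Strip ε)) (hV₃a : AnalyticOnNhd ℝ V₃ (Strip ε))
    (hV₄a : AnalyticOnNhd ℝ V₄ (Strip ε))
    (hV₂p : DoublyPeriodicOn ε V₂) (hV₃p : DoublyPeriodicOn ε V₃)
    (hV₄p : DoublyPeriodicOn ε V₄)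
    (hV₂0 : ∀ x y : ℝ, V₂ (x, y, 0) = 0) (hV₃0 : ∀ x y : ℝ, V₃ (x, y, 0) = 0)
    (hV₄0 : ∀ x y : ℝ, V₄ (x, y, 0) = 0)
    (heq1 : ∀ p ∈ Strip ε,
      g p * pT V₂ p =
        2 * (g p * pX g p + 2 * pX Λ p + pX u₀ p) * V₂ p
        + (4 * Λ p * pX f p + 2 * f p * pX Λ p) * V₃ p
        - 4 * V₂ p * V₃ p
        + g p * (g p * pX V₂ p - 2 * Λ p * pX V₄ p + f p * pY V₂ p
            + 2 * Λ p * pY V₃ p - 2 * pX Λ p * V₄ p))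
    (heq2 : ∀ p ∈ Strip ε,
      pT V₃ p = 2 * pY V₂ p + f p * pY V₃ p + g p * pY V₄ p
        + pY f p * V₃ p - pX f p * V₄ p)
    (heq3 : ∀ p ∈ Strip ε,
      pT V₄ p = -2 * pX V₂ p + f p * pX V₃ p + g p * pX V₄ p
        - pY g p * V₃ p + pX g p * V₄ p) :
    ∀ p ∈ Strip ε, V₂ p = 0 ∧ V₃ p = 0 ∧ V₄ p = 0 := by
  obtain ⟨hΛa, hua, hfa, hga, -, -, -, -, hsys, hinit⟩ := hsol
  have hΛ₁d : Differentiable ℝ Λ₁ := fun x => (hΛ₁a x trivial).differentiableAt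
  set S : Set ℝ := {x | deriv Λ₁ x ≠ 0}
  have hS : IsOpen S := isOpen_ne_fun hΛ₁a.deriv.continuous continuous_const
  have hSne : S.Nonempty := exists_deriv_ne_zero hΛ₁d hΛ₁nc
  have hpXΛ (x y : ℝ) : pX Λ (x, y, 0) = deriv Λ₁ x := by
    have h1 := hasDerivAt_slice_x (hΛa _ (mem_strip_zero hε x y)).differentiableAt
    simp only [(hinit _ _).1] at h1
    exact h1.unique ((hΛ₁d x).hasDerivAt.add_const _)
  have hpXu (x y : ℝ) : pX u₀ (x, y, 0) = -2 * deriv Λ₁ x := by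
    have h1 := hasDerivAt_slice_x (hua _ (mem_strip_zero hε x y)).differentiableAt
    simp only [(hinit _ _).2.1] at h1
    rw [h1.unique (((hΛ₁d x).hasDerivAt.const_mul 2).const_sub _), neg_mul]
  have hg1 : VanishesToOrder ε S 1 g :=
    (VanishesToOrder.one_iff hε hga).2 fun x _ y => (hinit x y).2.2.2
  have hf1 : VanishesToOrder ε S 1 f :=
    (VanishesToOrder.one_iff hε hfa).2 fun x _ y => (hinit x y).2.2.1
  have hΛ0 : VanishesToOrder ε S 0 Λ := .of_analytic hΛa
  have hu0 : VanishesToOrder ε S 0 u₀ := .of_analytic hua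
  have hΛX := hΛ0.pX hε hS
  have hK : VanishesToOrder ε S 1 (fun p => g p * pX g p + 2 * pX Λ p + pX u₀ p) := by
    refine (VanishesToOrder.one_iff hε ?_).2 fun x _ y => ?_
    · exact (((hg1.mono zero_le_one).mul hε ((hg1.pX hε hS).mono zero_le_one)).add
        (hΛX.const_mul hε 2) |>.add (hu0.pX hε hS)).1
    · simp only [hpXΛ, hpXu, (hinit x y).2.2.2]
      ring
  have hgT : ∀ x ∈ S, ∀ y, pT g (x, y, 0) ≠ 0 := fun x hx y => by
    rw [(hsys _ (mem_strip_zero hε x y)).2.2.2, hpXu]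
    exact mul_ne_zero (by norm_num) (mul_ne_zero (by norm_num) hx)
  have main (n : ℕ) : VanishesToOrder ε S (n + 1) V₂ ∧ VanishesToOrder ε S (n + 1) V₃ ∧
      VanishesToOrder ε S (n + 1) V₄ := by
    induction n with
    | zero =>
      exact ⟨(VanishesToOrder.one_iff hε hV₂a).2 fun x _ y => hV₂0 x y,
        (VanishesToOrder.one_iff hε hV₃a).2 fun x _ y => hV₃0 x y,
        (VanishesToOrder.one_iff hε hV₄a).2 fun x _ y => hV₄0 x y⟩
    | succ n ih =>
      obtain ⟨h2, h3, h4⟩ := ih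
      have mul1 {h k : ℝ × ℝ × ℝ → ℝ} (hh : VanishesToOrder ε S 1 h)
          (hk : VanishesToOrder ε S (n + 1) k) :
          VanishesToOrder ε S (n + 1 + 1) (fun p => h p * k p) :=
        (hh.mul hε hk).mono (by lia)
      have mul0 {m : ℕ} {h k : ℝ × ℝ × ℝ → ℝ} (hh : VanishesToOrder ε S 0 h)
          (hk : VanishesToOrder ε S m k) : VanishesToOrder ε S m (fun p => h p * k p) :=
        (hh.mul hε hk).mono (by lia)
      have hf0 := hf1.mono zero_le_one
      have hg0 := hg1.mono zero_le_one
      have h2X := h2.pX hε hS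
      have h2Y := h2.pY hε hS
      have h3X := h3.pX hε hS
      have h3Y := h3.pY hε hS
      have h4X := h4.pX hε hS
      have h4Y := h4.pY hε hS
      refine ⟨?_, ?_, ?_⟩
      · refine (VanishesToOrder.succ_iff hε hV₂a).2 ⟨fun x _ y => hV₂0 x y,
          .of_mul_left hε (hV₂a.fderiv_apply _) hga (fun x _ y => (hinit x y).2.2.2) hgT
            (.congr hε ?_ fun p hp => (heq1 p hp).symm)⟩
        refine .add (.sub (.add (mul1 (hK.const_mul hε 2) h2) (mul1 ?_ h3))
          (mul1 ((h2.mono (by lia)).const_mul hε 4) h3)) (mul1 hg1 ?_)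
        · exact (mul0 (hΛ0.const_mul hε 4) (hf1.pX hε hS)).add
            ((hf1.const_mul hε 2).mul hε hΛX)
        · exact ((((mul0 hg0 h2X).sub (mul0 (hΛ0.const_mul hε 2) h4X)).add (mul0 hf0 h2Y)).add
            (mul0 (hΛ0.const_mul hε 2) h3Y)).sub (mul0 (hΛX.const_mul hε 2) h4)
      · refine (VanishesToOrder.succ_iff hε hV₃a).2 ⟨fun x _ y => hV₃0 x y,
          .congr hε ?_ fun p hp => (heq2 p hp).symm⟩
        exact ((((h2Y.const_mul hε 2).add (mul0 hf0 h3Y)).add (mul0 hg0 h4Y)).add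
          (mul0 (hf0.pY hε hS) h3)).sub (mul0 (hf0.pX hε hS) h4)
      · refine (VanishesToOrder.succ_iff hε hV₄a).2 ⟨fun x _ y => hV₄0 x y,
          .congr hε ?_ fun p hp => (heq3 p hp).symm⟩
        exact ((((h2X.const_mul hε (-2)).add (mul0 hf0 h3X)).add (mul0 hg0 h4X)).sub
          (mul0 (hg0.pY hε hS) h3)).add (mul0 (hg0.pX hε hS) h4)
  intro p hp
  exact ⟨VanishesToOrder.eqOn_zero hε hS hSne (fun n => (main n).1.mono n.le_succ) hp,
    VanishesToOrder.eqOn_zero hε hS hSne (fun n => (main n).2.1.mono n.le_succ) hp,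
    VanishesToOrder.eqOn_zero hε hS hSne (fun n => (main n).2.2.mono n.le_succ) hp⟩
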